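/- Let A be an algebra with congruences α, β, δ. If β ⊓ (α ⊔ (β ⊓ δ)) ⊆ δ, then C(α,β;δ) holds, where ⊓ is intersection of congruences and ⊔ is join of congruences. -/

import Mathlib

open FirstOrder.Language FirstOrder.Language.Structure

universe u v w

/-- A binary relation on `A` is compatible with all (interpreted) operations of the
`L`-structure `A`. -/
def Compatible (L : FirstOrder.Language.{u, v}) (A : Type w) [L.Structure A]
    (T : A → A → Prop) : Prop :=
  ∀ (n : ℕ) (f : L.Functions n) (a b : Fin n → A),
    (∀ i, T (a i) (b i)) → T (funMap f a) (funMap f b)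

/-- A tolerance on `A`: a reflexive, symmetric, compatible binary relation. -/
def IsTolerance (L : FirstOrder.Language.{u, v}) (A : Type w) [L.Structure A]
    (T : A → A → Prop) : Prop :=
  Reflexive T ∧ Symmetric T ∧ Compatible L A T

/-- A congruence on `A`: a transitive tolerance. -/
def IsCongruence (L : FirstOrder.Language.{u, v}) (A : Type w) [L.Structure A]
    (T : A → A → Prop) : Prop :=
  IsTolerance L A T ∧ Transitive T

/-- The centralizer condition `C(S, T; δ)`: for every term `t(x, y₁, …, yₙ)`
(variable `0` playing the role of `x`), every `(a, b) ∈ S` and all pairs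
`(uᵢ, vᵢ) ∈ T`, if `(t(a, ū), t(a, v̄)) ∈ δ` then `(t(b, ū), t(b, v̄)) ∈ δ`. -/
def Centralizes (L : FirstOrder.Language.{u, v}) (A : Type w) [L.Structure A]
    (S T δ : A → A → Prop) : Prop :=
  ∀ (n : ℕ) (t : L.Term (Fin (n + 1))) (a b : A), S a b →
    ∀ u v : Fin n → A, (∀ i, T (u i) (v i)) →
      (δ (t.realize (Fin.cons a u)) (t.realize (Fin.cons a v)) →
        δ (t.realize (Fin.cons b u)) (t.realize (Fin.cons b v)))

/-- A compatible relation is preserved by every term operation. -/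
theorem Compatible.realize {L : FirstOrder.Language.{u, v}} {A : Type w} [L.Structure A]
    {T : A → A → Prop} (hT : Compatible L A T) {ι : Type*} (t : L.Term ι) {x y : ι → A}
    (hxy : ∀ i, T (x i) (y i)) : T (t.realize x) (t.realize y) := by
  induction t with
  | var i => exact hxy i
  | func f _ ih => exact hT _ f _ _ ih

/-- Theorem 2.19 (8): if `β ⊓ (α ⊔ (β ⊓ δ)) ⊆ δ` for congruences `α, β, δ`, then
`C(α, β; δ)` holds. Here the join is the transitive closure of the union. -/
theorem centralizes_of_meet_join_le {L : FirstOrder.Language.{u, v}}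
    {A : Type w} [L.Structure A] (α β δ : A → A → Prop)
    (hα : IsCongruence L A α) (hβ : IsCongruence L A β) (hδ : IsCongruence L A δ)
    (h : ∀ a b : A, β a b →
      Relation.TransGen (fun x y => α x y ∨ (β x y ∧ δ x y)) a b → δ a b) :
    Centralizes L A α β δ := by
  obtain ⟨⟨hαr, hαs, hαc⟩, -⟩ := hα
  obtain ⟨⟨hβr, -, hβc⟩, -⟩ := hβ
  intro n t a b hab u v huv hδuv
  have hα_term (w : Fin n → A) :
      α (t.realize (Fin.cons a w)) (t.realize (Fin.cons b w)) :=
    hαc.realize t (Fin.cases hab fun i => hαr (w i))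
  have hβ_term (c : A) : β (t.realize (Fin.cons c u)) (t.realize (Fin.cons c v)) :=
    hβc.realize t (Fin.cases (hβr c) huv)
  exact h _ _ (hβ_term b) <|
    .head (Or.inl (hαs (hα_term u))) <|
      .head (Or.inr ⟨hβ_term a, hδuv⟩) <| .single (Or.inl (hα_term v))
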